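/- arXiv:2307.12434 — 3 statements merged into one kernel-verified Lean document; each statement's English description precedes it below -/
import Mathlib

section
/- Let k be an integer with k ≤ 0. With the convention a(0,k) = 1 and a(m,k) = 0 for m < 0, the counts a(n,k) satisfy the recurrence a(n,k) = a(n−1,k) + 2·a(n−2,k) − a(n−2+k,k) for every integer n ≥ 3. -/
/-- A composition of `n`: a list of positive integers summing to `n`. -/
def IsComposition (n : ℤ) (l : List ℕ) : Prop :=
  (∀ x ∈ l, 0 < x) ∧ (l.sum : ℤ) = n

/-- Generalized Arndt condition with integer shift `k`:
`c_{2i-1} > c_{2i} + k` for every pair of consecutive parts. -/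
def ArndtCondK (k : ℤ) (l : List ℕ) : Prop :=
  ∀ i : ℕ, 2 * i + 1 < l.length →
    (l.getD (2 * i + 1) 0 : ℤ) + k < (l.getD (2 * i) 0 : ℤ)

theorem arndtCondK_cons_cons {k : ℤ} {x y : ℕ} {t : List ℕ} :
    ArndtCondK k (x :: y :: t) ↔ (y : ℤ) + k < x ∧ ArndtCondK k t := by
  constructor
  · intro h
    refine ⟨by simpa using h 0 (by simp), fun i hi => ?_⟩
    have := h (i + 1) (by simp only [List.length_cons]; omega)
    simpa [Nat.mul_add, List.getD_cons_succ] using this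
  · rintro ⟨h0, h⟩ (_ | i) hi
    · simpa using h0
    · simp only [List.length_cons] at hi
      simpa [Nat.mul_add, List.getD_cons_succ] using h i (by omega)

theorem isComposition_cons_cons {n : ℤ} {x y : ℕ} {t : List ℕ} :
    IsComposition n (x :: y :: t) ↔ 0 < x ∧ 0 < y ∧ IsComposition (n - x - y) t := by
  simp only [IsComposition, List.forall_mem_cons, List.sum_cons, Nat.cast_add]
  constructor
  · rintro ⟨⟨hx, hy, ht⟩, hs⟩
    exact ⟨hx, hy, ht, by omega⟩
  · rintro ⟨hx, hy, ht, hs⟩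
    exact ⟨⟨hx, hy, ht⟩, by omega⟩

theorem finite_isComposition (n : ℕ) : {l : List ℕ | IsComposition n l}.Finite := by
  refine (Set.finite_range fun c : Composition n => c.blocks).subset ?_
  rintro l ⟨hpos, hsum⟩
  exact ⟨⟨l, fun h => hpos _ h, by exact_mod_cast hsum⟩, rfl⟩

/-- The finset of generalized Arndt compositions of `n` with shift `k`. -/
noncomputable def arndtFinset (k : ℤ) (n : ℕ) : Finset (List ℕ) :=
  ((finite_isComposition n).subset
    (fun _ h => h.1 : {l : List ℕ | IsComposition n l ∧ ArndtCondK k l} ⊆ _)).toFinset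

theorem mem_arndtFinset {k : ℤ} {n : ℕ} {l : List ℕ} :
    l ∈ arndtFinset k n ↔ IsComposition n l ∧ ArndtCondK k l := by
  simp [arndtFinset]

theorem natCard_arndt (k : ℤ) (n : ℕ) :
    Nat.card {l : List ℕ // IsComposition n l ∧ ArndtCondK k l} = (arndtFinset k n).card := by
  exact Nat.card_eq_card_finite_toFinset _

theorem card_arndtFinset_length_lt_two (k : ℤ) (n : ℕ) :
    ((arndtFinset k n).filter fun l => ¬ 2 ≤ l.length).card = 1 := by
  rw [Finset.card_eq_one]
  refine ⟨if n = 0 then [] else [n], ?_⟩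
  ext l
  simp only [Finset.mem_filter, mem_arndtFinset, Finset.mem_singleton]
  rcases l with _ | ⟨x, _ | ⟨y, t⟩⟩
  · by_cases hn : n = 0 <;> simp [IsComposition, ArndtCondK, hn, eq_comm]
  · by_cases hn : n = 0
    · simp [IsComposition, hn]; omega
    · simp [IsComposition, ArndtCondK, hn]; omega
  · by_cases hn : n = 0 <;> simp [hn]

theorem card_arndtFinset_two_le_length (m n : ℕ) :
    ((arndtFinset (-m) n).filter fun l => 2 ≤ l.length).card =
      ∑ ij ∈ Finset.HasAntidiagonal.antidiagonal n,
        (ij.1 - (ij.1 - m) / 2 - 1) * (arndtFinset (-m) ij.2).card := by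
  simp_rw [← Nat.card_Ioo, ← Finset.card_product]
  rw [← Finset.card_sigma]
  symm
  refine Finset.card_bij (fun q _ => q.2.1 :: (q.1.1 - q.2.1) :: q.2.2) ?_ ?_ ?_
  · rintro ⟨⟨i, j⟩, x, t⟩ h
    simp only [Finset.mem_sigma, Finset.HasAntidiagonal.mem_antidiagonal, Finset.mem_product, Finset.mem_Ioo,
      mem_arndtFinset] at h
    obtain ⟨hij, ⟨hx, hxi⟩, ht, ht'⟩ := h
    simp only [Finset.mem_filter, mem_arndtFinset, isComposition_cons_cons,
      arndtCondK_cons_cons, List.length_cons]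
    refine ⟨⟨⟨by omega, by omega, ?_⟩, by omega, ht'⟩, by omega⟩
    convert ht using 1
    omega
  · rintro ⟨⟨i, j⟩, x, t⟩ h ⟨⟨i', j'⟩, x', t'⟩ h' heq
    simp only [Finset.mem_sigma, Finset.HasAntidiagonal.mem_antidiagonal, Finset.mem_product, Finset.mem_Ioo]
      at h h'
    simp only [List.cons.injEq] at heq
    obtain ⟨rfl, hy, rfl⟩ := heq
    obtain rfl : i = i' := by omega
    obtain rfl : j = j' := by omega
    rfl
  · rintro l h
    rw [Finset.mem_filter, mem_arndtFinset] at h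
    rcases l with _ | ⟨x, _ | ⟨y, t⟩⟩
    · simp at h
    · simp at h
    · obtain ⟨⟨hc, ha⟩, -⟩ := h
      rw [isComposition_cons_cons] at hc
      rw [arndtCondK_cons_cons] at ha
      obtain ⟨hx, hy, ht⟩ := hc
      have hs := ht.2
      refine ⟨⟨(x + y, t.sum), x, t⟩, ?_, by simp⟩
      simp only [Finset.mem_sigma, Finset.HasAntidiagonal.mem_antidiagonal, Finset.mem_product, Finset.mem_Ioo,
        mem_arndtFinset]
      exact ⟨by omega, ⟨by omega, by omega⟩, ⟨ht.1, rfl⟩, ha.2⟩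

open PowerSeries in
theorem pairs_genFun (m : ℕ) :
    (1 - X) * (1 - X ^ 2) * (mk fun i => ((i - (i - m) / 2 - 1 : ℕ) : ℤ)) =
      X ^ 2 * (1 + X - X ^ m) := by
  have h : (1 - X ^ 2) * (mk fun i => ((i - (i - m) / 2 - 1 : ℕ) : ℤ)) =
      X ^ 2 * (mk fun i => (1 + (if i < m then 1 else 0) - (if i = 0 then 1 else 0) : ℤ)) := by
    ext n
    simp only [sub_mul, one_mul, map_sub, coeff_X_pow_mul', coeff_mk]
    split_ifs <;> omega
  have h' : (1 - X) * (mk fun i => (1 + (if i < m then 1 else 0) - (if i = 0 then 1 else 0) : ℤ)) =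
      1 + X - X ^ m := by
    ext n
    rcases n with _ | n
    · simp only [sub_mul, one_mul, map_sub, map_add, coeff_zero_X_mul, coeff_mk, coeff_one,
        coeff_X, coeff_X_pow]
      grind
    · simp only [sub_mul, one_mul, map_sub, map_add, coeff_succ_X_mul, coeff_mk, coeff_one,
        coeff_X, coeff_X_pow]
      grind
  rw [mul_assoc, h, mul_left_comm, h']

open PowerSeries in
theorem arndt_genFun (m : ℕ) :
    (mk fun n => ((arndtFinset (-m) n).card : ℤ)) * (1 - X - 2 * X ^ 2 + X ^ (m + 2)) =
      1 - X ^ 2 := by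
  have hA : (mk fun n => ((arndtFinset (-m) n).card : ℤ)) = mk 1 +
      (mk fun i => ((i - (i - m) / 2 - 1 : ℕ) : ℤ)) *
        mk fun n => ((arndtFinset (-m) n).card : ℤ) := by
    ext n
    simp only [map_add, coeff_mul, coeff_mk, Pi.one_apply]
    rw [← Finset.card_filter_add_card_filter_not (s := arndtFinset (-m) n)
      (fun l => 2 ≤ l.length), card_arndtFinset_length_lt_two, card_arndtFinset_two_le_length]
    push_cast
    ring
  have h1 : (mk 1 : ℤ⟦X⟧) * (1 - X) = 1 := mk_one_mul_one_sub_eq_one ℤ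
  linear_combination (1 - X) * (1 - X ^ 2) * hA + (1 - X ^ 2) * h1 +
    (mk fun n => ((arndtFinset (-m) n).card : ℤ)) * pairs_genFun m

theorem arndt_recurrence_nonpos (k : ℤ) (hk : k ≤ 0) (a : ℤ → ℕ)
    (ha0 : a 0 = 1) (haneg : ∀ m : ℤ, m < 0 → a m = 0)
    (hapos : ∀ m : ℤ, 0 < m →
      a m = Nat.card {l : List ℕ // IsComposition m l ∧ ArndtCondK k l}) :
    ∀ n : ℤ, 3 ≤ n →
      (a n : ℤ) = a (n - 1) + 2 * a (n - 2) - a (n - 2 + k) := by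
  obtain ⟨m, rfl⟩ : ∃ m : ℕ, k = -m := ⟨(-k).toNat, by omega⟩
  have ha : ∀ j : ℕ, a j = (arndtFinset (-m) j).card := by
    rintro (_ | j)
    · have h := congrArg (PowerSeries.coeff 0) (arndt_genFun m)
      simp at h
      simp [ha0, h]
    · rw [hapos _ (by omega), natCard_arndt]
  intro n hn
  obtain ⟨j, rfl⟩ : ∃ j : ℕ, n = j + 3 := ⟨(n - 3).toNat, by omega⟩
  have h := congrArg (PowerSeries.coeff (j + 3)) (arndt_genFun m)
  rw [mul_comm] at h
  rw [show (j + 3 : ℤ) = (j + 3 : ℕ) by simp, show ((j + 3 : ℕ) : ℤ) - 1 = (j + 2 : ℕ) by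
    push_cast; ring, show ((j + 3 : ℕ) : ℤ) - 2 = (j + 1 : ℕ) by push_cast; ring]
  have h2 : (2 : PowerSeries ℤ) = PowerSeries.C 2 := by simp
  simp only [add_mul, sub_mul, one_mul, map_sub, map_add, h2, mul_assoc, PowerSeries.coeff_C_mul,
    PowerSeries.coeff_X_pow_mul', PowerSeries.coeff_succ_X_mul, PowerSeries.coeff_mk,
    PowerSeries.coeff_one, PowerSeries.coeff_X_pow] at h
  simp only [ha]
  by_cases hm : m + 2 ≤ j + 3
  · rw [show ((j + 1 : ℕ) : ℤ) + -m = (j + 1 - m : ℕ) by omega, ha]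
    simp [hm] at h
    linarith
  · rw [haneg _ (by omega)]
    simp [hm] at h
    push_cast
    linarith
end

section
/- Fix an integer k ≥ 1 and let c^{2k}_odd(n) denote the number of compositions of n each of whose parts is either odd or an even number belonging to {2, 4, …, 2k}, with the conventions c^{2k}_odd(0) = 1 and c^{2k}_odd(m) = 0 for m < 0. Then for every integer n ≥ 3, c^{2k}_odd(n) = c^{2k}_odd(n−1) + 2·c^{2k}_odd(n−2) − c^{2k}_odd(n−2−2k). -/
/-- The compositions of `n` whose parts are odd or at most `2 * k`. -/
def oddOrSmallCompositions (k n : ℤ) : Set (List ℕ) :=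
  {l | IsComposition n l ∧ ∀ x ∈ l, Odd x ∨ (Even x ∧ (x : ℤ) ≤ 2 * k)}

theorem mem_oddOrSmallCompositions_cons {k n : ℤ} {a : ℕ} {l : List ℕ} :
    a :: l ∈ oddOrSmallCompositions k n ↔
      (0 < a ∧ (Odd a ∨ (Even a ∧ (a : ℤ) ≤ 2 * k))) ∧ l ∈ oddOrSmallCompositions k (n - a) := by
  simp only [oddOrSmallCompositions, IsComposition, Set.mem_ofPred_eq, List.forall_mem_cons,
    List.sum_cons, Nat.cast_add, eq_sub_iff_add_eq']
  tauto

theorem nil_mem_oddOrSmallCompositions {k n : ℤ} :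
    [] ∈ oddOrSmallCompositions k n ↔ n = 0 := by
  simp [oddOrSmallCompositions, IsComposition, eq_comm]

theorem finite_oddOrSmallCompositions (k n : ℤ) : (oddOrSmallCompositions k n).Finite := by
  refine (Set.finite_range (Composition.blocks : Composition n.toNat → List ℕ)).subset ?_
  rintro l ⟨⟨hpos, hsum⟩, -⟩
  exact ⟨⟨l, fun {i} hi => hpos i hi, by omega⟩, rfl⟩

theorem oddOrSmallCompositions_of_neg (k : ℤ) {n : ℤ} (hn : n < 0) :
    oddOrSmallCompositions k n = ∅ := by
  rw [Set.eq_empty_iff_forall_notMem]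
  rintro l ⟨⟨-, hsum⟩, -⟩
  omega

theorem oddOrSmallCompositions_zero (k : ℤ) : oddOrSmallCompositions k 0 = {[]} := by
  ext l
  cases l with
  | nil => simp [nil_mem_oddOrSmallCompositions]
  | cons a l =>
    simp only [mem_oddOrSmallCompositions_cons, Set.mem_singleton_iff, reduceCtorEq, iff_false]
    rintro ⟨⟨ha, -⟩, hl⟩
    rw [oddOrSmallCompositions_of_neg k (by omega)] at hl
    exact hl

theorem oddOrSmallCompositions_eq_union {k : ℕ} (hk : 1 ≤ k) {n : ℤ} (hn : 3 ≤ n) :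
    oddOrSmallCompositions k n =
      List.cons 1 '' oddOrSmallCompositions k (n - 1) ∪
        (List.cons 2 '' oddOrSmallCompositions k (n - 2) ∪
          List.modifyHead (· + 2) '' (oddOrSmallCompositions k (n - 2) \
            List.cons (2 * k) '' oddOrSmallCompositions k (n - 2 - 2 * k))) := by
  ext l
  constructor
  · rcases l with _ | ⟨a, l⟩
    · rw [nil_mem_oddOrSmallCompositions]
      omega
    rw [mem_oddOrSmallCompositions_cons]
    rintro ⟨⟨ha, ha'⟩, hl⟩
    obtain rfl | rfl | h3 : a = 1 ∨ a = 2 ∨ 3 ≤ a := by omega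
    · exact Or.inl ⟨l, by simpa using hl, rfl⟩
    · exact Or.inr (Or.inl ⟨l, by simpa using hl, rfl⟩)
    · obtain ⟨b, rfl⟩ : ∃ b, a = b + 2 := ⟨a - 2, by omega⟩
      refine Or.inr (Or.inr ⟨b :: l, ⟨?_, ?_⟩, rfl⟩)
      · rw [mem_oddOrSmallCompositions_cons]
        refine ⟨⟨by omega, by grind⟩, ?_⟩
        convert hl using 2
        push_cast
        ring
      · rintro ⟨l', -, h⟩
        grind
  · rintro (⟨l, hl, rfl⟩ | ⟨l, hl, rfl⟩ | ⟨l, ⟨hl, hl'⟩, rfl⟩)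
    · exact mem_oddOrSmallCompositions_cons.2 ⟨by simp, by simpa using hl⟩
    · refine mem_oddOrSmallCompositions_cons.2 ⟨⟨by simp, Or.inr ⟨by simp, ?_⟩⟩, by simpa using hl⟩
      push_cast
      omega
    · rcases l with _ | ⟨b, l⟩
      · rw [nil_mem_oddOrSmallCompositions] at hl
        omega
      obtain ⟨⟨hb, hb'⟩, hl⟩ := mem_oddOrSmallCompositions_cons.1 hl
      have hne : b ≠ 2 * k := by
        rintro rfl
        exact hl' ⟨l, by simpa using hl, rfl⟩
      rw [List.modifyHead_cons, mem_oddOrSmallCompositions_cons]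
      refine ⟨⟨by omega, by grind⟩, ?_⟩
      convert hl using 2
      push_cast
      ring

theorem ncard_oddOrSmallCompositions {k : ℕ} (hk : 1 ≤ k) {n : ℤ} (hn : 3 ≤ n) :
    (oddOrSmallCompositions k n).ncard + (oddOrSmallCompositions k (n - 2 - 2 * k)).ncard =
      (oddOrSmallCompositions k (n - 1)).ncard + 2 * (oddOrSmallCompositions k (n - 2)).ncard := by
  have hfin := finite_oddOrSmallCompositions k
  have hsub : List.cons (2 * k) '' oddOrSmallCompositions k (n - 2 - 2 * k) ⊆
      oddOrSmallCompositions k (n - 2) := by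
    rintro _ ⟨l, hl, rfl⟩
    exact mem_oddOrSmallCompositions_cons.2
      ⟨⟨by omega, Or.inr ⟨by simp, by simp⟩⟩, by simpa using hl⟩
  have hinj : Function.Injective (List.modifyHead (· + 2) : List ℕ → List ℕ) := by
    rintro (_ | ⟨a, l⟩) (_ | ⟨b, l'⟩) h <;> simp_all
  have hcons (a : ℕ) : Function.Injective (List.cons a) := List.cons_injective
  have hdiff := Set.ncard_sdiff_add_ncard_of_subset hsub (hfin _)
  rw [Set.ncard_image_of_injective _ (hcons _)] at hdiff
  rw [oddOrSmallCompositions_eq_union hk hn, Set.ncard_union_eq ?_ ((hfin _).image _)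
      (((hfin _).image _).union ((hfin _).sdiff.image _)),
    Set.ncard_union_eq ?_ ((hfin _).image _) ((hfin _).sdiff.image _),
    Set.ncard_image_of_injective _ (hcons _), Set.ncard_image_of_injective _ (hcons _),
    Set.ncard_image_of_injective _ hinj]
  · omega
  · rw [Set.disjoint_left]
    rintro _ ⟨l, -, rfl⟩ ⟨_ | ⟨b, l'⟩, ⟨hl', -⟩, h⟩
    · simp at h
    · have := (mem_oddOrSmallCompositions_cons.1 hl').1.1
      simp at h
      omega
  · rw [Set.disjoint_left]
    rintro _ ⟨l, -, rfl⟩ (⟨l', -, h⟩ | ⟨_ | ⟨b, l'⟩, -, h⟩) <;> simp at h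

/-- `c n` counts the compositions of `n` whose parts are all odd or even
numbers in `{2, 4, …, 2k}`; it satisfies
`c(n) = c(n-1) + 2·c(n-2) - c(n-2-2k)` for `n ≥ 3`. -/
theorem codd_recurrence (k : ℤ) (hk : 1 ≤ k) (c : ℤ → ℕ)
    (hc0 : c 0 = 1) (hcneg : ∀ m : ℤ, m < 0 → c m = 0)
    (hcpos : ∀ m : ℤ, 0 < m →
      c m = Nat.card {l : List ℕ // IsComposition m l ∧
        ∀ x ∈ l, Odd x ∨ (Even x ∧ (x : ℤ) ≤ 2 * k)}) :
    ∀ n : ℤ, 3 ≤ n →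
      (c n : ℤ) = c (n - 1) + 2 * c (n - 2) - c (n - 2 - 2 * k) := by
  intro n hn
  lift k to ℕ using by omega
  have hc (m : ℤ) : c m = (oddOrSmallCompositions k m).ncard := by
    rcases lt_trichotomy m 0 with hm | rfl | hm
    · rw [hcneg m hm, oddOrSmallCompositions_of_neg _ hm, Set.ncard_empty]
    · rw [hc0, oddOrSmallCompositions_zero, Set.ncard_singleton]
    · exact hcpos m hm
  have h := ncard_oddOrSmallCompositions (by omega : 1 ≤ k) hn
  simp only [← hc] at h
  omega
end

section
/- Fix an integer k ≥ 1 and let c^{2k+1}_even(n) denote the number of compositions of n each of whose parts is either even or an odd number belonging to {1, 3, …, 2k+1}, with the conventions c^{2k+1}_even(0) = 1 and c^{2k+1}_even(m) = 0 for m < 0. Then for every integer n ≥ 3, c^{2k+1}_even(n) = c^{2k+1}_even(n−1) + 2·c^{2k+1}_even(n−2) − c^{2k+1}_even(n−2−2k−1). -/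
/-- The compositions of `n` whose odd parts are at most `2k+1`. -/
def boundedOddCompositions (k n : ℤ) : Set (List ℕ) :=
  {l | IsComposition n l ∧ ∀ x ∈ l, Even x ∨ (Odd x ∧ (x : ℤ) ≤ 2 * k + 1)}

namespace boundedOddCompositions

theorem cons_mem_iff {k n : ℤ} {x : ℕ} {l : List ℕ} :
    x :: l ∈ boundedOddCompositions k n ↔
      (0 < x ∧ (Even x ∨ (Odd x ∧ (x : ℤ) ≤ 2 * k + 1))) ∧
        l ∈ boundedOddCompositions k (n - x) := by
  simp only [boundedOddCompositions, IsComposition, Set.mem_ofPred_eq, List.forall_mem_cons,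
    List.sum_cons, Nat.cast_add, eq_sub_iff_add_eq']
  tauto

theorem nil_mem_iff {k n : ℤ} : [] ∈ boundedOddCompositions k n ↔ n = 0 := by
  simp [boundedOddCompositions, IsComposition, eq_comm]

theorem finite (k n : ℤ) : (boundedOddCompositions k n).Finite := by
  refine (Set.finite_range (Composition.blocks (n := n.toNat))).subset ?_
  rintro l ⟨⟨hpos, hsum⟩, -⟩
  exact ⟨⟨l, fun {_} hx => hpos _ hx, by omega⟩, rfl⟩

theorem eq_empty_of_neg {k n : ℤ} (hn : n < 0) : boundedOddCompositions k n = ∅ := by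
  ext l
  simp only [boundedOddCompositions, IsComposition, Set.mem_ofPred_eq, Set.mem_empty_iff_false,
    iff_false]
  rintro ⟨⟨-, h⟩, -⟩
  omega

theorem zero_eq (k : ℤ) : boundedOddCompositions k 0 = {[]} := by
  ext l
  cases l with
  | nil => simp [nil_mem_iff]
  | cons x l =>
    simp only [cons_mem_iff, Set.mem_singleton_iff, reduceCtorEq, iff_false]
    rintro ⟨⟨hx, -⟩, hl⟩
    rw [eq_empty_of_neg (by omega)] at hl
    exact hl

theorem ncard_image_cons (k n : ℤ) (x : ℕ) :
    (List.cons x '' boundedOddCompositions k n).ncard = (boundedOddCompositions k n).ncard :=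
  Set.ncard_image_of_injective _ (List.cons_injective)

/-- The compositions in `boundedOddCompositions k n` whose first part is different from `2k+1`. -/
def headNe (k : ℕ) (n : ℤ) : Set (List ℕ) :=
  {l ∈ boundedOddCompositions k n | l.head? ≠ some (2 * k + 1)}

theorem eq_union_headNe (k : ℕ) (n : ℤ) :
    boundedOddCompositions k n =
      List.cons (2 * k + 1) '' boundedOddCompositions k (n - 2 * k - 1) ∪ headNe k n := by
  ext l
  cases l with
  | nil => simp [headNe]
  | cons x l =>
    by_cases hx : x = 2 * k + 1
    · subst hx
      simp [headNe, cons_mem_iff, sub_sub]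
    · simp [headNe, hx, Ne.symm hx]

theorem ncard_eq_add_headNe (k : ℕ) (n : ℤ) :
    (boundedOddCompositions k n).ncard =
      (boundedOddCompositions k (n - 2 * k - 1)).ncard + (headNe k n).ncard := by
  rw [← ncard_image_cons k (n - 2 * k - 1) (2 * k + 1)]
  nth_rw 1 [eq_union_headNe]
  refine Set.ncard_union_eq ?_ ((finite _ _).image _) ((finite _ _).subset (Set.sep_subset _ _))
  rw [Set.disjoint_left]
  rintro _ ⟨l, -, rfl⟩ h
  exact h.2 rfl

theorem modifyHead_add_two_injective :
    Function.Injective (List.modifyHead (· + 2) : List ℕ → List ℕ) := by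
  rintro (_ | ⟨x, l⟩) (_ | ⟨y, m⟩) h <;> simp_all

/-- A composition starts with `1`, with `2`, or with a part obtained by adding two to a part other
than `2k+1`. -/
theorem eq_union_modifyHead (k : ℕ) {n : ℤ} (hn : 3 ≤ n) :
    boundedOddCompositions k n =
      List.cons 1 '' boundedOddCompositions k (n - 1) ∪
        (List.cons 2 '' boundedOddCompositions k (n - 2) ∪
          List.modifyHead (· + 2) '' headNe k (n - 2)) := by
  ext l
  have hnil : [] ∉ headNe k (n - 2) := fun h => by
    have := nil_mem_iff.1 h.1
    omega
  rcases l with _ | ⟨_ | _ | _ | x, l⟩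
  · have : n ≠ 0 := by omega
    simpa [nil_mem_iff, this] using hnil
  · simp only [cons_mem_iff, lt_self_iff_false, false_and, false_iff]
    rintro (⟨m, -, h⟩ | ⟨m, -, h⟩ | ⟨_ | ⟨y, m⟩, -, h⟩) <;> simp at h
  · have : ∀ m ∈ headNe k (n - 2), m.modifyHead (· + 2) ≠ 1 :: l := by
      rintro (_ | ⟨y, m⟩) - h <;> simp at h
    simp [cons_mem_iff]
    grind
  · have : ∀ m ∈ headNe k (n - 2), m.modifyHead (· + 2) ≠ 2 :: l := by
      rintro (_ | ⟨y, m⟩) hm h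
      · simp at h
      · have := (cons_mem_iff.1 hm.1).1.1
        simp at h
        omega
    simp [cons_mem_iff]
    grind
  · have himage : (x + 3) :: l ∈ List.modifyHead (· + 2) '' headNe k (n - 2) ↔
        (x + 1) :: l ∈ headNe k (n - 2) :=
      modifyHead_add_two_injective.mem_set_image (a := (x + 1) :: l)
    have hsub : n - ((x + 3 : ℕ) : ℤ) = n - 2 - ((x + 1 : ℕ) : ℤ) := by push_cast; ring
    have hodd : (0 < x + 3 ∧ (Even (x + 3) ∨ (Odd (x + 3) ∧ ((x + 3 : ℕ) : ℤ) ≤ 2 * k + 1))) ↔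
        (0 < x + 1 ∧ (Even (x + 1) ∨ (Odd (x + 1) ∧ ((x + 1 : ℕ) : ℤ) ≤ 2 * k + 1))) ∧
          x + 1 ≠ 2 * k + 1 := by
      simp only [Nat.even_iff, Nat.odd_iff]
      omega
    have hmem : (x + 3) :: l ∈ boundedOddCompositions k n ↔ (x + 1) :: l ∈ headNe k (n - 2) := by
      rw [cons_mem_iff, hsub, hodd, headNe, Set.mem_sep_iff, cons_mem_iff, List.head?_cons, ne_eq,
        ne_eq, Option.some_inj]
      tauto
    rw [Set.mem_union, Set.mem_union, himage, hmem]
    simp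

theorem ncard_eq_add_modifyHead (k : ℕ) {n : ℤ} (hn : 3 ≤ n) :
    (boundedOddCompositions k n).ncard =
      (boundedOddCompositions k (n - 1)).ncard +
        ((boundedOddCompositions k (n - 2)).ncard + (headNe k (n - 2)).ncard) := by
  have hfin : (headNe k (n - 2)).Finite := (finite _ _).subset (Set.sep_subset _ _)
  rw [← ncard_image_cons k (n - 1) 1, ← ncard_image_cons k (n - 2) 2,
    ← Set.ncard_image_of_injective (headNe k (n - 2)) modifyHead_add_two_injective,
    eq_union_modifyHead k hn, Set.ncard_union_eq ?_ ((finite _ _).image _)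
      (((finite _ _).image _).union (hfin.image _)),
    Set.ncard_union_eq ?_ ((finite _ _).image _) (hfin.image _)]
  · rw [Set.disjoint_left]
    rintro _ ⟨l, -, rfl⟩ ⟨_ | ⟨y, m⟩, hm, h⟩
    · simp at h
    · have := (cons_mem_iff.1 hm.1).1.1
      simp at h
      omega
  · rw [Set.disjoint_left]
    rintro _ ⟨l, -, rfl⟩ (⟨m, -, h⟩ | ⟨_ | ⟨y, m⟩, -, h⟩) <;> simp at h

theorem ncard_recurrence (k : ℕ) {n : ℤ} (hn : 3 ≤ n) :
    ((boundedOddCompositions k n).ncard : ℤ) =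
      (boundedOddCompositions k (n - 1)).ncard + 2 * (boundedOddCompositions k (n - 2)).ncard -
        (boundedOddCompositions k (n - 2 - 2 * k - 1)).ncard := by
  have h₁ := ncard_eq_add_modifyHead k hn
  have h₂ := ncard_eq_add_headNe k (n - 2)
  omega

end boundedOddCompositions

/-- `c n` counts the compositions of `n` whose parts are all even or odd
numbers in `{1, 3, …, 2k+1}`; it satisfies
`c(n) = c(n-1) + 2·c(n-2) - c(n-2-2k-1)` for `n ≥ 3`. -/
theorem ceven_recurrence (k : ℤ) (hk : 1 ≤ k) (c : ℤ → ℕ)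
    (hc0 : c 0 = 1) (hcneg : ∀ m : ℤ, m < 0 → c m = 0)
    (hcpos : ∀ m : ℤ, 0 < m →
      c m = Nat.card {l : List ℕ // IsComposition m l ∧
        ∀ x ∈ l, Even x ∨ (Odd x ∧ (x : ℤ) ≤ 2 * k + 1)}) :
    ∀ n : ℤ, 3 ≤ n →
      (c n : ℤ) = c (n - 1) + 2 * c (n - 2) - c (n - 2 - 2 * k - 1) := by
  have hc : ∀ m, c m = (boundedOddCompositions k m).ncard := by
    intro m
    rcases lt_trichotomy m 0 with hm | rfl | hm
    · rw [hcneg m hm, boundedOddCompositions.eq_empty_of_neg hm, Set.ncard_empty]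
    · rw [hc0, boundedOddCompositions.zero_eq, Set.ncard_singleton]
    · rw [hcpos m hm]
      rfl
  intro n hn
  lift k to ℕ using by omega
  simp only [hc]
  exact boundedOddCompositions.ncard_recurrence k hn
end
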